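/- (McGarvey) For every skew-symmetric function F : C × C → ℤ on a finite candidate set C (with F(c,c) = 0) such that all values F(c,c') have the same parity as 0 relative to an even base (i.e., all F(c,c') are even), there exists a voting profile T (a finite list of linear orders on C) whose pairwise score differences satisfy D_T(c,c') = F(c,c') for all distinct c, c'. -/

import Mathlib

/-- Position function of the two votes attached to the ordered pair `(a, b)`. -/
def mcgPos {C : Type*} [DecidableEq C] (N : ℕ) (e : C → ℕ) (a b : C) (t : Bool) (c : C) : ℕ :=
  if t then (if c = a then 0 else if c = b then 1 else 2 + e c)
  else (if c = a then N else if c = b then N + 1 else N - 1 - e c)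

theorem mcgPos_inj {C : Type*} [DecidableEq C] (N : ℕ) (e : C → ℕ)
    (he : Function.Injective e) (hN : ∀ c, e c < N) (a b : C) (t : Bool) :
    Function.Injective (mcgPos N e a b t) := by
  intro c d h
  have h1 := hN c
  have h2 := hN d
  have h3 := @he c d
  unfold mcgPos at h
  cases t <;> simp only [if_true, Bool.false_eq_true, if_false] at h <;> grind

/-- Net contribution of one vote. -/
def mcgSgn (x y : ℕ) : ℤ := (if x < y then 1 else 0) - (if y < x then 1 else 0)

theorem mcgPos_score {C : Type*} [DecidableEq C] (N : ℕ) (e : C → ℕ)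
    (he : Function.Injective e) (hN : ∀ c, e c < N) (a b : C) (hab : a ≠ b) (c d : C)
    (hcd : c ≠ d) :
    mcgSgn (mcgPos N e a b true c) (mcgPos N e a b true d)
      + mcgSgn (mcgPos N e a b false c) (mcgPos N e a b false d)
    = (if c = a then (if d = b then 2 else 0) else 0)
      - (if d = a then (if c = b then 2 else 0) else 0) := by
  have h1 := hN c
  have h2 := hN d
  have h3 : e c ≠ e d := fun h => hcd (he h)
  unfold mcgPos mcgSgn
  simp only [if_true, Bool.false_eq_true, if_false]
  by_cases ca : c = a <;> by_cases cb : c = b <;> by_cases da : d = a <;> by_cases db : d = b <;>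
    simp only [ca, cb, da, db, if_true, if_false] <;> grind

/-- McGarvey: for every skew-symmetric, everywhere-even
`F : C × C → ℤ` on a finite set with at least 3 candidates, there is a profile
of linear orders (given by injective position functions) whose pairwise score
differences realize `F`. -/
theorem mcgarvey {C : Type*} [Fintype C] [DecidableEq C]
    (hC : 3 ≤ Fintype.card C)
    (F : C → C → ℤ) (hskew : ∀ c c', F c c' = -F c' c)
    (heven : ∀ c c', Even (F c c')) :
    ∃ (n : ℕ) (pos : Fin n → C → ℕ),
      (∀ i, Function.Injective (pos i)) ∧
      ∀ c c', c ≠ c' →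
        ((Finset.univ.filter fun i => pos i c < pos i c').card : ℤ)
          - (Finset.univ.filter fun i => pos i c' < pos i c).card
        = F c c' := by
  let e : C → ℕ := fun c => (Fintype.equivFin C c : ℕ)
  have he : Function.Injective e := fun x y h => (Fintype.equivFin C).injective (Fin.ext h)
  have hN : ∀ c, e c < Fintype.card C := fun c => (Fintype.equivFin C c).2
  let k : C → C → ℕ := fun a b => (F a b / 2).toNat
  let ι := Σ p : C × C, Fin (k p.1 p.2) × Bool
  let q : ι → C → ℕ := fun i => mcgPos (Fintype.card C) e i.1.1 i.1.2 i.2.2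
  refine ⟨Fintype.card ι, fun i => q ((Fintype.equivFin ι).symm i), fun i =>
    mcgPos_inj _ e he hN _ _ _, fun c d hcd => ?_⟩
  have key : ∀ a b, (k a b : ℤ) * (mcgSgn (mcgPos (Fintype.card C) e a b true c)
        (mcgPos (Fintype.card C) e a b true d)
      + mcgSgn (mcgPos (Fintype.card C) e a b false c) (mcgPos (Fintype.card C) e a b false d))
      = (if c = a then (if d = b then 2 * (k a b : ℤ) else 0) else 0)
      - (if d = a then (if c = b then 2 * (k a b : ℤ) else 0) else 0) := by
    intro a b
    by_cases hab : a = b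
    · subst hab
      have h0 : F a a = 0 := by have := hskew a a; omega
      have : k a a = 0 := by simp [k, h0]
      simp [this]
    · rw [mcgPos_score _ e he hN a b hab c d hcd]
      split_ifs <;> ring
  have h1 : ∑ i : Fin (Fintype.card ι), mcgSgn (q ((Fintype.equivFin ι).symm i) c)
      (q ((Fintype.equivFin ι).symm i) d) = F c d := by
    rw [Equiv.sum_comp (Fintype.equivFin ι).symm (fun i => mcgSgn (q i c) (q i d))]
    rw [Fintype.sum_sigma, Fintype.sum_prod_type]
    have : ∀ a b, ∑ y : Fin (k a b) × Bool, mcgSgn (q ⟨(a, b), y⟩ c) (q ⟨(a, b), y⟩ d)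
        = (if c = a then (if d = b then 2 * (k a b : ℤ) else 0) else 0)
      - (if d = a then (if c = b then 2 * (k a b : ℤ) else 0) else 0) := by
      intro a b
      rw [← key a b, Fintype.sum_prod_type]
      simp [q]
    refine (Finset.sum_congr rfl fun a _ => Finset.sum_congr rfl fun b _ => this a b).trans ?_
    have e1 : ∀ x y : C, ∑ a, ∑ b, (if x = a then (if y = b then 2 * (k a b : ℤ) else 0) else 0)
        = 2 * (k x y : ℤ) := by
      intro x y
      rw [Finset.sum_eq_single x (fun a _ h => by simp [h.symm]) (by simp)]
      simp
    simp only [Finset.sum_sub_distrib, e1]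
    obtain ⟨m, hm⟩ := heven c d
    have := hskew c d
    simp only [k]
    omega
  rw [← h1]
  simp only [mcgSgn, Finset.sum_sub_distrib, Finset.sum_boole]
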